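/- For every integer d ≥ 1 there exist a constant C > 0 and, for each n ≥ 2, a point set x₁, …, xₙ ∈ [0,1]^d whose star discrepancy satisfies D*ₙ(x₁, …, xₙ) ≤ C (log n)^{d−1} / n. In particular, quasi-Monte Carlo point sets achieve star discrepancy of order O(n^{−1} (log n)^{d−1}), which tends to 0 faster than the O(n^{−1/2}) Monte Carlo rate. -/

import Mathlib

open Filter

/-- The star discrepancy of the points `x 0, …, x (n-1)` in `[0,1]^d`:
`D*ₙ = sup_{a ∈ [0,1]^d} |Vol([0,a]) − (1/n)·#{i : xᵢ ∈ [0,a]}|`. -/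
noncomputable def starDiscrepancy (d n : ℕ) (x : Fin n → Fin d → ℝ) : ℝ :=
  ⨆ a : {a : Fin d → ℝ // ∀ j, a j ∈ Set.Icc (0 : ℝ) 1},
    |(∏ j, a.1 j) -
      ((Finset.univ.filter fun i : Fin n => ∀ j, 0 ≤ x i j ∧ x i j ≤ a.1 j).card : ℝ) / n|

/-- `IsResidueSum S L δ f` says that `f` is a sum of `L` indicator functions of residue classes
whose moduli have all their prime factors in `S` and whose densities add up to `δ`. -/
inductive IsResidueSum (S : Finset ℕ) : ℕ → ℝ → (ℕ → ℝ) → Prop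
  | zero : IsResidueSum S 0 0 (fun _ => 0)
  | add_class {L : ℕ} {δ : ℝ} {f : ℕ → ℝ} (M r : ℕ) (hM : M ≠ 0) (hS : M.primeFactors ⊆ S)
      (hf : IsResidueSum S L δ f) :
      IsResidueSum S (L + 1) (δ + 1 / M) (fun i => f i + if i ≡ r [MOD M] then 1 else 0)

namespace IsResidueSum

variable {S T : Finset ℕ} {L L' : ℕ} {δ δ' : ℝ} {f g : ℕ → ℝ}

theorem residueClass {M : ℕ} (r : ℕ) (hM : M ≠ 0) (hS : M.primeFactors ⊆ S) :
    IsResidueSum S 1 (1 / M) (fun i => if i ≡ r [MOD M] then 1 else 0) := by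
  simpa using add_class M r hM hS zero

theorem one : IsResidueSum S 1 1 (fun _ => 1) := by
  simpa [Nat.modEq_one] using residueClass (S := S) (M := 1) 0 one_ne_zero (by simp)

theorem add (hf : IsResidueSum S L δ f) (hg : IsResidueSum S L' δ' g) :
    IsResidueSum S (L + L') (δ + δ') (fun i => f i + g i) := by
  induction hg with
  | zero => simpa using hf
  | add_class M r hM hS _ ih =>
    simpa only [← add_assoc] using ih.add_class M r hM hS

theorem mul_residueClass (hST : Disjoint S T) (hf : IsResidueSum S L δ f) {M : ℕ} (r : ℕ)
    (hM : M ≠ 0) (hT : M.primeFactors ⊆ T) :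
    IsResidueSum (S ∪ T) L (δ * (1 / M)) (fun i => f i * if i ≡ r [MOD M] then 1 else 0) := by
  induction hf with
  | zero => simpa using zero
  | add_class N t hN hS _ ih =>
    have hco : N.Coprime M :=
      (Nat.disjoint_primeFactors hN hM).1 (Finset.disjoint_of_subset_left hS
        (Finset.disjoint_of_subset_right hT hST))
    convert ih.add_class (N * M) (Nat.chineseRemainder hco t r : ℕ) (mul_ne_zero hN hM) ?_
      using 1
    · push_cast
      field_simp
    · funext i
      have h : i ≡ (Nat.chineseRemainder hco t r : ℕ) [MOD N * M] ↔
          i ≡ t [MOD N] ∧ i ≡ r [MOD M] := by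
        rw [← Nat.modEq_and_modEq_iff_modEq_mul hco]
        have h1 := (Nat.chineseRemainder hco t r).2.1
        have h2 := (Nat.chineseRemainder hco t r).2.2
        exact ⟨fun h => ⟨h.1.trans h1, h.2.trans h2⟩,
          fun h => ⟨h.1.trans h1.symm, h.2.trans h2.symm⟩⟩
      simp only [h, add_mul]
      by_cases h1 : i ≡ t [MOD N] <;> by_cases h2 : i ≡ r [MOD M] <;> simp [h1, h2]
    · rw [Nat.primeFactors_mul hN hM]
      exact Finset.union_subset_union hS hT

theorem mul (hST : Disjoint S T) (hf : IsResidueSum S L δ f) (hg : IsResidueSum T L' δ' g) :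
    IsResidueSum (S ∪ T) (L * L') (δ * δ') (fun i => f i * g i) := by
  induction hg with
  | zero => simpa using zero
  | add_class M r hM hT _ ih =>
    simpa only [mul_add, mul_one] using ih.add (hf.mul_residueClass hST r hM hT)

theorem prod {ι : Type*} [DecidableEq ι] (J : Finset ι) {b : ι → ℕ} (hb : b.Injective)
    {L : ι → ℕ} {δ : ι → ℝ} {f : ι → ℕ → ℝ} (hf : ∀ j, IsResidueSum {b j} (L j) (δ j) (f j)) :
    IsResidueSum (J.image b) (∏ j ∈ J, L j) (∏ j ∈ J, δ j) (fun i => ∏ j ∈ J, f j i) := by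
  induction J using Finset.induction_on with
  | empty => simpa using one
  | insert a J ha ih =>
    simp only [Finset.prod_insert ha, Finset.image_insert]
    rw [Finset.insert_eq]
    refine (hf a).mul ?_ ih
    simpa [Finset.disjoint_singleton_left, hb.eq_iff] using ha

theorem abs_sum_range_sub_le (hf : IsResidueSum S L δ f) (m : ℕ) :
    |∑ i ∈ Finset.range m, f i - m * δ| ≤ L := by
  induction hf with
  | zero => simp
  | @add_class L δ f M r hM _ _ ih =>
    have hM' : (0 : ℝ) < M := by positivity
    have hcount : ∑ i ∈ Finset.range m, (if i ≡ r [MOD M] then (1 : ℝ) else 0) =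
        (m / M : ℕ) + if r % M < m % M then 1 else 0 := by
      have h := Nat.count_modEq_card (r := M) m (Nat.pos_of_ne_zero hM) r
      rw [Finset.sum_boole, ← Nat.count_eq_card_filter_range, h]
      push_cast
      rfl
    have hdiv : (m : ℝ) * (1 / M) = (m / M : ℕ) + (m % M : ℕ) / M := by
      have h : (m : ℝ) = M * (m / M : ℕ) + (m % M : ℕ) := by
        exact_mod_cast (Nat.div_add_mod m M).symm
      field_simp
      linarith
    have h0 : (0 : ℝ) ≤ (m % M : ℕ) / M := by positivity
    have h1 : ((m % M : ℕ) : ℝ) / M ≤ 1 := by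
      rw [div_le_one hM']
      exact_mod_cast (Nat.mod_lt m (Nat.pos_of_ne_zero hM)).le
    have hclass : |∑ i ∈ Finset.range m, (if i ≡ r [MOD M] then (1 : ℝ) else 0) - m * (1 / M)|
        ≤ 1 := by
      rw [hcount, hdiv, abs_le]
      split_ifs <;> constructor <;> linarith
    rw [Finset.sum_add_distrib, mul_add, add_sub_add_comm]
    push_cast
    exact (abs_add_le _ _).trans (add_le_add ih hclass)

theorem comp_div {b : ℕ} (hb : b.Prime) {q : ℕ} (hq : q < b) (hf : IsResidueSum {b} L δ f) :
    IsResidueSum {b} L (δ / b) (fun i => if i % b = q then f (i / b) else 0) := by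
  induction hf with
  | zero => simpa using zero
  | add_class M r hM hS _ ih =>
    convert ih.add_class (b * M) (q + b * r) (mul_ne_zero hb.ne_zero hM) ?_ using 1
    · have := hb.ne_zero
      push_cast
      field_simp
    · funext i
      have h : i ≡ q + b * r [MOD b * M] ↔ i % b = q ∧ i / b ≡ r [MOD M] := by
        have h1 : (q + b * r) % b = q := by simp [Nat.mod_eq_of_lt hq]
        have h2 : (q + b * r) / b = r := by
          rw [Nat.add_mul_div_left _ _ hb.pos, Nat.div_eq_of_lt hq, zero_add]
        unfold Nat.ModEq
        rw [Nat.mod_mul, Nat.mod_mul, h1, h2]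
        constructor
        · intro h
          have h3 := congrArg (· % b) h
          have h4 := congrArg (· / b) h
          simp only [Nat.add_mul_mod_self_left, Nat.mod_mod, Nat.mod_eq_of_lt hq] at h3
          simp only [Nat.add_mul_div_left _ _ hb.pos, Nat.div_eq_of_lt hq,
            Nat.div_eq_of_lt (Nat.mod_lt i hb.pos), zero_add] at h4
          exact ⟨h3, h4⟩
        · rintro ⟨h3, h4⟩
          rw [h3, h4]
      simp only [h]
      by_cases h1 : i % b = q <;> simp [h1]
    · rw [Nat.primeFactors_mul hb.ne_zero hM, hb.primeFactors]
      exact Finset.union_subset subset_rfl hS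

theorem mod_lt {b : ℕ} (hb : b.Prime) {q : ℕ} (hq : q ≤ b) :
    IsResidueSum {b} q (q / b) (fun i => if i % b < q then 1 else 0) := by
  induction q with
  | zero => simpa using zero
  | succ q ih =>
    convert (ih (by omega)).add_class b q hb.ne_zero (by simp [hb.primeFactors]) using 1
    · push_cast
      ring
    · funext i
      have h : i ≡ q [MOD b] ↔ i % b = q := by rw [Nat.ModEq, Nat.mod_eq_of_lt hq]
      rcases lt_trichotomy (i % b) q with h' | h' | h'
      · simp [h, h', h'.ne, h'.trans (Nat.lt_succ_self q)]
      · simp [h, h']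
      · simp [h, h'.ne', h'.not_gt, (Nat.succ_le_of_lt h').not_gt]

end IsResidueSum

/-- The number obtained from `i` by reversing the order of its `K` lowest digits in base `b`. -/
def digitReverse (b : ℕ) : ℕ → ℕ → ℕ
  | 0, _ => 0
  | K + 1, i => i % b * b ^ K + digitReverse b K (i / b)

theorem digitReverse_lt {b : ℕ} (hb : 0 < b) (K i : ℕ) : digitReverse b K i < b ^ K := by
  induction K generalizing i with
  | zero => simp [digitReverse]
  | succ K ih =>
    have h1 := ih (i / b)
    have h2 : i % b + 1 ≤ b := Nat.mod_lt i hb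
    calc digitReverse b (K + 1) i < (i % b + 1) * b ^ K := by
          rw [digitReverse, add_mul, one_mul]; omega
      _ ≤ b * b ^ K := Nat.mul_le_mul_right _ h2
      _ = b ^ (K + 1) := (pow_succ' b K).symm

theorem isResidueSum_digitReverse_lt {b : ℕ} (hb : b.Prime) (K : ℕ) {c : ℕ} (hc : c ≤ b ^ K) :
    ∃ L ≤ b * K + 1, IsResidueSum {b} L (c / b ^ K)
      (fun i => if digitReverse b K i < c then 1 else 0) := by
  have hb0 : (b : ℝ) ≠ 0 := by exact_mod_cast hb.ne_zero
  induction K generalizing c with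
  | zero =>
    obtain rfl | rfl : c = 0 ∨ c = 1 := by
      rw [pow_zero] at hc
      omega
    · exact ⟨0, by omega, by simpa using IsResidueSum.zero⟩
    · exact ⟨1, by omega, by simpa [digitReverse] using IsResidueSum.one⟩
  | succ K ih =>
    rcases hc.eq_or_lt with rfl | hc
    · refine ⟨1, by omega, ?_⟩
      simpa [digitReverse_lt hb.pos, hb0] using IsResidueSum.one (S := {b})
    have hpos : 0 < b ^ K := pow_pos hb.pos K
    have hq : c / b ^ K < b := Nat.div_lt_of_lt_mul (by rwa [← pow_succ])
    obtain ⟨L, hL, h⟩ := ih (Nat.mod_lt c hpos).le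
    refine ⟨c / b ^ K + L, by rw [mul_add]; omega, ?_⟩
    convert (IsResidueSum.mod_lt hb hq.le).add (h.comp_div hb hq) using 1
    · have h : (c : ℝ) = b ^ K * (c / b ^ K : ℕ) + (c % b ^ K : ℕ) := by
        exact_mod_cast (Nat.div_add_mod c (b ^ K)).symm
      rw [pow_succ]
      field_simp
      linarith
    · funext i
      have hlt := digitReverse_lt hb.pos K (i / b)
      have hdm := Nat.div_add_mod' c (b ^ K)
      have hle := Nat.div_mul_le_self c (b ^ K)
      have hmod := Nat.mod_lt c hpos
      have hrev : digitReverse b (K + 1) i = i % b * b ^ K + digitReverse b K (i / b) := rfl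
      rcases lt_trichotomy (i % b) (c / b ^ K) with h' | h' | h'
      · have : (i % b + 1) * b ^ K ≤ c / b ^ K * b ^ K := Nat.mul_le_mul_right _ h'
        rw [add_mul, one_mul] at this
        rw [if_pos (by omega), if_pos h', if_neg h'.ne, add_zero]
      · rw [if_neg h'.not_lt, if_pos h', zero_add]
        rw [h'] at hrev
        exact if_congr (by omega) rfl rfl
      · have : (c / b ^ K + 1) * b ^ K ≤ i % b * b ^ K := Nat.mul_le_mul_right _ h'
        rw [add_mul, one_mul] at this
        rw [if_neg (by omega), if_neg h'.not_gt, if_neg h'.ne', add_zero]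

/-- A threshold for real parameters in `[0,1]`: comparing the fraction `k / N` with `a` amounts to
comparing `k` with a natural number at distance at most `1` from `N * a`. -/
theorem exists_nat_threshold {N : ℕ} (hN : 0 < N) {a : ℝ} (ha : a ∈ Set.Icc (0 : ℝ) 1) :
    ∃ c ≤ N, |(c : ℝ) - N * a| ≤ 1 ∧ ∀ k < N, ((k : ℝ) / N ≤ a ↔ k < c) := by
  have hN' : (0 : ℝ) < N := by exact_mod_cast hN
  have hNa : 0 ≤ N * a := mul_nonneg hN'.le ha.1
  have h1 := Nat.floor_le hNa
  have h2 := Nat.lt_floor_add_one (N * a)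
  have h3 : N * a ≤ N := mul_le_of_le_one_right hN'.le ha.2
  refine ⟨min N (⌊N * a⌋₊ + 1), min_le_left _ _, ?_, fun k hk => ?_⟩
  · rw [abs_le]
    push_cast
    rcases min_cases (N : ℝ) (⌊N * a⌋₊ + 1) with h | h <;> constructor <;> linarith
  · rw [div_le_iff₀' hN', ← Nat.le_floor_iff hNa]
    omega

theorem abs_prod_sub_prod_le_sum {ι : Type*} (J : Finset ι) {u v : ι → ℝ}
    (hu : ∀ j, u j ∈ Set.Icc (0 : ℝ) 1) (hv : ∀ j, v j ∈ Set.Icc (0 : ℝ) 1) :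
    |∏ j ∈ J, u j - ∏ j ∈ J, v j| ≤ ∑ j ∈ J, |u j - v j| := by
  classical
  induction J using Finset.induction_on with
  | empty => simp
  | insert a J ha ih =>
    simp only [Finset.prod_insert ha, Finset.sum_insert ha]
    have hP : |∏ j ∈ J, u j| ≤ 1 := by
      rw [Finset.abs_prod]
      exact Finset.prod_le_one (fun _ _ => abs_nonneg _)
        (fun j _ => (abs_of_nonneg (hu j).1).trans_le (hu j).2)
    have hva : |v a| ≤ 1 := (abs_of_nonneg (hv a).1).trans_le (hv a).2
    calc |u a * ∏ j ∈ J, u j - v a * ∏ j ∈ J, v j|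
        = |(u a - v a) * ∏ j ∈ J, u j + v a * (∏ j ∈ J, u j - ∏ j ∈ J, v j)| := by ring_nf
      _ ≤ |u a - v a| * |∏ j ∈ J, u j| + |v a| * |∏ j ∈ J, u j - ∏ j ∈ J, v j| := by
          rw [← abs_mul, ← abs_mul]; exact abs_add_le _ _
      _ ≤ |u a - v a| * 1 + 1 * ∑ j ∈ J, |u j - v j| := by gcongr
      _ = _ := by ring

/-- The Hammersley point set with `n` points and `K` digits in the bases `b j`. -/
noncomputable def hammersley {s : ℕ} (b : Fin s → ℕ) (K n : ℕ) (i : Fin n) : Fin (s + 1) → ℝ :=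
  Fin.cons ((i : ℝ) / n) fun j => (digitReverse (b j) K i : ℝ) / (b j ^ K : ℕ)

theorem hammersley_mem_Icc {s : ℕ} {b : Fin s → ℕ} (hb : ∀ j, (b j).Prime) (K n : ℕ) (i : Fin n)
    (j : Fin (s + 1)) : hammersley b K n i j ∈ Set.Icc (0 : ℝ) 1 := by
  refine Fin.cases ?_ (fun j => ?_) j
  · simp only [hammersley, Fin.cons_zero]
    exact ⟨by positivity, div_le_one_of_le₀ (by exact_mod_cast i.2.le) (by positivity)⟩
  · simp only [hammersley, Fin.cons_succ]
    exact ⟨by positivity, div_le_one_of_le₀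
      (by exact_mod_cast (digitReverse_lt (hb j).pos K i).le) (by positivity)⟩

theorem abs_hammersley_count_sub_le {s : ℕ} {b : Fin s → ℕ} (hb : ∀ j, (b j).Prime)
    (hinj : b.Injective) {K n : ℕ} (hn : 0 < n) (hK : n ≤ 2 ^ K) {a : Fin (s + 1) → ℝ}
    (ha : ∀ j, a j ∈ Set.Icc (0 : ℝ) 1) :
    |((Finset.univ.filter fun i : Fin n =>
        ∀ j, 0 ≤ hammersley b K n i j ∧ hammersley b K n i j ≤ a j).card : ℝ) - n * ∏ j, a j| ≤
      ∏ j, ((b j * K + 1 : ℕ) : ℝ) + (1 + s) := by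
  obtain ⟨m, hmn, hm, hm'⟩ := exists_nat_threshold hn (ha 0)
  choose c hcb hc hc' using fun j : Fin s =>
    exists_nat_threshold (pow_pos (hb j).pos K) (ha j.succ)
  choose L hL hres using fun j : Fin s => isResidueSum_digitReverse_lt (hb j) K (hcb j)
  have hcount : ((Finset.univ.filter fun i : Fin n =>
      ∀ j, 0 ≤ hammersley b K n i j ∧ hammersley b K n i j ≤ a j).card : ℝ) =
      ∑ i ∈ Finset.range m, ∏ j, if digitReverse (b j) K i < c j then (1 : ℝ) else 0 := by
    have hiff : ∀ i : Fin n,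
        (∀ j, 0 ≤ hammersley b K n i j ∧ hammersley b K n i j ≤ a j) ↔
          ((i : ℕ) < m ∧ ∀ j, digitReverse (b j) K i < c j) := by
      intro i
      simp only [(hammersley_mem_Icc hb K n i _).1, true_and, Fin.forall_fin_succ]
      simp only [hammersley, Fin.cons_zero, Fin.cons_succ]
      rw [hm' i i.2]
      simp only [hc' _ _ (digitReverse_lt (hb _).pos K i)]
    simp only [hiff]
    rw [← Finset.sum_boole, Fin.sum_univ_eq_sum_range
      (fun i => if i < m ∧ ∀ j, digitReverse (b j) K i < c j then (1 : ℝ) else 0) n]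
    rw [← Finset.sum_subset (Finset.range_mono hmn)
      (fun i _ hi => if_neg fun h => hi (Finset.mem_range.2 h.1))]
    refine Finset.sum_congr rfl fun i hi => ?_
    rw [Finset.prod_boole]
    simp [Finset.mem_range.1 hi]
  set P := ∏ j, ((c j : ℝ) / b j ^ K)
  set Q := ∏ j : Fin s, a j.succ with hQ
  have hcmem : ∀ j, (c j : ℝ) / b j ^ K ∈ Set.Icc (0 : ℝ) 1 := fun j =>
    ⟨by positivity, div_le_one_of_le₀ (by exact_mod_cast hcb j) (by positivity)⟩
  have hP0 : 0 ≤ P := Finset.prod_nonneg fun j _ => (hcmem j).1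
  have hP1 : P ≤ 1 := Finset.prod_le_one (fun j _ => (hcmem j).1) fun j _ => (hcmem j).2
  have hmain : |(n : ℝ) * (P - Q)| ≤ s := by
    rw [abs_mul, Nat.abs_cast]
    calc (n : ℝ) * |P - Q| ≤ n * ∑ j, |(c j : ℝ) / b j ^ K - a j.succ| := by
          gcongr
          exact abs_prod_sub_prod_le_sum _ hcmem fun j => ha j.succ
      _ = ∑ j, n * |(c j : ℝ) / b j ^ K - a j.succ| := Finset.mul_sum _ _ _
      _ ≤ ∑ _j : Fin s, (1 : ℝ) := by
          refine Finset.sum_le_sum fun j _ => ?_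
          have hB : (0 : ℝ) < (b j : ℝ) ^ K := by
            have := (hb j).pos
            positivity
          have hnB : (n : ℝ) ≤ (b j : ℝ) ^ K := by
            exact_mod_cast hK.trans (Nat.pow_le_pow_left (hb j).two_le K)
          calc (n : ℝ) * |(c j : ℝ) / b j ^ K - a j.succ|
              ≤ (b j : ℝ) ^ K * |(c j : ℝ) / b j ^ K - a j.succ| := by gcongr
            _ = |(c j : ℝ) - (b j ^ K : ℕ) * a j.succ| := by
                rw [← abs_of_pos hB, ← abs_mul, abs_of_pos hB, mul_sub, mul_div_cancel₀ _ hB.ne']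
                push_cast
                rfl
            _ ≤ 1 := hc j
      _ = s := by simp
  have hcrt : |∑ i ∈ Finset.range m, (∏ j, if digitReverse (b j) K i < c j then (1 : ℝ) else 0)
      - m * P| ≤ ∏ j, ((b j * K + 1 : ℕ) : ℝ) := by
    refine ((IsResidueSum.prod Finset.univ hinj hres).abs_sum_range_sub_le m).trans ?_
    rw [Nat.cast_prod]
    exact Finset.prod_le_prod (fun _ _ => by positivity) fun j _ => by exact_mod_cast hL j
  have hlast : |((m : ℝ) - n * a 0) * Q| ≤ 1 := by
    have hQ1 : |Q| ≤ 1 := by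
      rw [hQ, Finset.abs_prod]
      exact Finset.prod_le_one (fun _ _ => abs_nonneg _)
        (fun j _ => (abs_of_nonneg (ha _).1).trans_le (ha _).2)
    rw [abs_mul]
    exact mul_le_one₀ hm (abs_nonneg _) hQ1
  have hmain' : |(m : ℝ) * (P - Q)| ≤ s := by
    refine le_trans ?_ hmain
    rw [abs_mul, abs_mul, Nat.abs_cast, Nat.abs_cast]
    gcongr
  rw [hcount, Fin.prod_univ_succ, ← hQ]
  calc _ = |(∑ i ∈ Finset.range m, (∏ j, if digitReverse (b j) K i < c j then (1 : ℝ) else 0)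
          - m * P) + (((m : ℝ) - n * a 0) * Q + m * (P - Q))| := by ring_nf
    _ ≤ _ := (abs_add_le _ _).trans (add_le_add hcrt
        ((abs_add_le _ _).trans (add_le_add hlast hmain')))

theorem starDiscrepancy_hammersley_le {s : ℕ} {b : Fin s → ℕ} (hb : ∀ j, (b j).Prime)
    (hinj : b.Injective) {K n : ℕ} (hn : 0 < n) (hK : n ≤ 2 ^ K) :
    starDiscrepancy (s + 1) n (hammersley b K n) ≤
      (∏ j, ((b j * K + 1 : ℕ) : ℝ) + (1 + s)) / n := by
  have hn' : (0 : ℝ) < n := by exact_mod_cast hn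
  refine Real.iSup_le (fun a => ?_) (by positivity)
  rw [le_div_iff₀ hn', ← abs_of_pos hn', ← abs_mul, abs_of_pos hn', sub_mul,
    div_mul_cancel₀ _ hn'.ne', abs_sub_comm, mul_comm (∏ j, a.1 j)]
  exact abs_hammersley_count_sub_le hb hinj hn hK a.2

theorem natLog_add_one_le_log {n : ℕ} (hn : 2 ≤ n) :
    ((Nat.log 2 n + 1 : ℕ) : ℝ) ≤ 4 * Real.log n := by
  have h2 := Real.log_two_gt_d9
  have hn' : Real.log 2 ≤ Real.log n := Real.log_le_log (by norm_num) (by exact_mod_cast hn)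
  have h : (Nat.log 2 n : ℝ) * Real.log 2 ≤ Real.log n := by
    rw [← Real.log_pow]
    exact Real.log_le_log (by positivity) (by exact_mod_cast Nat.pow_log_le_self 2 (by omega))
  have h0 : (0 : ℝ) ≤ Nat.log 2 n := by positivity
  push_cast
  nlinarith

theorem tendsto_log_pow_div_div_rpow (k : ℕ) :
    Tendsto (fun n : ℕ => ((Real.log n) ^ k / n) / (n : ℝ) ^ (-(1/2 : ℝ))) atTop (nhds 0) := by
  have h := ((isLittleO_log_rpow_rpow_atTop (k : ℝ)
    (show (0 : ℝ) < 1 / 2 by norm_num)).tendsto_div_nhds_zero).comp tendsto_natCast_atTop_atTop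
  refine h.congr' ?_
  filter_upwards [eventually_gt_atTop 0] with n hn
  have hn' : (0 : ℝ) < n := by exact_mod_cast hn
  simp only [Function.comp_apply, Real.rpow_natCast]
  rw [div_div]
  congr 1
  nth_rewrite 2 [← Real.rpow_one (n : ℝ)]
  rw [← Real.rpow_add hn']
  norm_num

/-- For every dimension `d ≥ 1` there is a constant `C > 0` such that for every `n ≥ 2`
there is an `n`-point set in `[0,1]^d` with star discrepancy at most
`C (log n)^{d−1} / n`; moreover this quantity tends to `0` faster than the Monte Carlo
rate `n^{−1/2}`, i.e. `((log n)^{d−1}/n) / n^{−1/2} = (log n)^{d−1}/√n → 0`. -/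
theorem exists_low_discrepancy_pointset (d : ℕ) (hd : 1 ≤ d) :
    (∃ C : ℝ, 0 < C ∧ ∀ n : ℕ, 2 ≤ n →
      ∃ x : Fin n → Fin d → ℝ, (∀ i j, x i j ∈ Set.Icc (0 : ℝ) 1) ∧
        starDiscrepancy d n x ≤ C * (Real.log n) ^ (d - 1) / n) ∧
    Tendsto (fun n : ℕ => ((Real.log n) ^ (d - 1) / n) / (n : ℝ) ^ (-(1/2 : ℝ)))
      atTop (nhds 0) := by
  refine ⟨?_, tendsto_log_pow_div_div_rpow (d - 1)⟩
  obtain ⟨s, rfl⟩ : ∃ s, d = s + 1 := ⟨d - 1, by omega⟩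
  rw [Nat.add_sub_cancel]
  let b : Fin s → ℕ := fun j => Nat.nth Nat.Prime j
  have hb : ∀ j, (b j).Prime := fun j => Nat.prime_nth_prime j
  have hinj : b.Injective := fun i j h =>
    Fin.ext (Nat.nth_injective Nat.infinite_setOfPred_prime h)
  refine ⟨(∏ j, ((b j : ℝ) + 1) + (1 + s)) * 4 ^ s, by positivity, fun n hn => ?_⟩
  set K := Nat.log 2 n + 1
  have hK : n ≤ 2 ^ K := (Nat.lt_pow_succ_log_self one_lt_two n).le
  refine ⟨hammersley b K n, hammersley_mem_Icc hb K n,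
    (starDiscrepancy_hammersley_le hb hinj (by omega) hK).trans ?_⟩
  have hK1 : (1 : ℝ) ≤ K := by exact_mod_cast Nat.le_add_left 1 (Nat.log 2 n)
  gcongr
  calc ∏ j, ((b j * K + 1 : ℕ) : ℝ) + (1 + s)
      ≤ ∏ j, (((b j : ℝ) + 1) * K) + (1 + s) * (K : ℝ) ^ s := by
        gcongr with j
        · push_cast
          linarith
        · exact le_mul_of_one_le_right (by positivity) (one_le_pow₀ hK1)
    _ = (∏ j, ((b j : ℝ) + 1) + (1 + s)) * (K : ℝ) ^ s := by
        rw [Finset.prod_mul_distrib, Finset.prod_const, Finset.card_univ, Fintype.card_fin, ← add_mul]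
    _ ≤ (∏ j, ((b j : ℝ) + 1) + (1 + s)) * (4 * Real.log n) ^ s := by
        gcongr
        exact natLog_add_one_le_log hn
    _ = _ := by rw [mul_pow, mul_assoc]
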